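/- (Weak duality for the inner load-shedding problem.) For every primal feasible point (p, θ, ℓ, p^g) and every dual feasible point (π, φ, ω, γ⁺, γ⁻, δ⁺, δ⁻), the dual objective is at most the primal objective: Σ_β ((y_β − 1) ξ^G_β p^gu_β φ_β − ω_β − p^d_β π_β) − Σ_e (M x_e (1 − ξ^L_e)(δ⁺_e + δ⁻_e) + (1 − x_e) ξ^L_e t_e (γ⁺_e + γ⁻_e)) ≤ Σ_β p^d_β ℓ_β. -/

import Mathlib

open Finset

/-- Primal feasibility for the inner load-shedding problem PLS_s. -/
def PrimalFeasible {B L : Type*} [Fintype L] [DecidableEq B]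
    (src dst : L → B) (b t : L → ℝ) (pd pgu : B → ℝ) (M : ℝ)
    (x ξL : L → ℝ) (y ξG : B → ℝ)
    (p : L → ℝ) (θ ℓ pg : B → ℝ) : Prop :=
  (∀ β, pg β - pd β * (1 - ℓ β) =
      (∑ e ∈ univ.filter (fun e => dst e = β), p e) -
      (∑ e ∈ univ.filter (fun e => src e = β), p e)) ∧
  (∀ β, 0 ≤ pg β ∧ pg β ≤ (1 - y β) * ξG β * pgu β) ∧
  (∀ e, |p e| ≤ (1 - x e) * ξL e * t e) ∧
  (∀ e, |p e + b e * (θ (src e) - θ (dst e))| ≤ M * x e * (1 - ξL e)) ∧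
  (∀ β, 0 ≤ ℓ β ∧ ℓ β ≤ 1)

/-- Dual feasibility for the inner load-shedding problem DLS_s. -/
def DualFeasible {B L : Type*} [Fintype L] [DecidableEq B]
    (src dst : L → B) (b : L → ℝ) (pd : B → ℝ)
    (π φ ω : B → ℝ) (γp γm δp δm : L → ℝ) : Prop :=
  (∀ e, π (src e) - π (dst e) + γp e - γm e + δp e - δm e = 0) ∧
  (∀ β, (∑ e ∈ univ.filter (fun e => dst e = β), b e * (δp e - δm e)) -
        (∑ e ∈ univ.filter (fun e => src e = β), b e * (δp e - δm e)) = 0) ∧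
  (∀ β, -π β - φ β = 0) ∧
  (∀ β, -(pd β) * π β - ω β ≤ pd β) ∧
  (∀ β, 0 ≤ φ β ∧ 0 ≤ ω β) ∧
  (∀ e, 0 ≤ γp e ∧ 0 ≤ γm e ∧ 0 ≤ δp e ∧ 0 ≤ δm e)

/-- Dual objective of DLS_s. -/
def dualObj {B L : Type*} [Fintype B] [Fintype L]
    (t : L → ℝ) (pd pgu : B → ℝ) (M : ℝ)
    (x ξL : L → ℝ) (y ξG : B → ℝ)
    (π φ ω : B → ℝ) (γp γm δp δm : L → ℝ) : ℝ :=
  (∑ β, ((y β - 1) * ξG β * pgu β * φ β - ω β - pd β * π β)) -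
  (∑ e, (M * x e * (1 - ξL e) * (δp e + δm e) +
         (1 - x e) * ξL e * t e * (γp e + γm e)))

lemma sum_net {B L : Type*} [Fintype B] [Fintype L] [DecidableEq B]
    (src dst : L → B) (u : B → ℝ) (f : L → ℝ) :
    ∑ β, u β * ((∑ e ∈ univ.filter (fun e => dst e = β), f e) -
      (∑ e ∈ univ.filter (fun e => src e = β), f e)) =
    ∑ e, f e * (u (dst e) - u (src e)) := by
  have key : ∀ g : L → B, ∑ β, u β * (∑ e ∈ univ.filter (fun e => g e = β), f e) =
      ∑ e, f e * u (g e) := by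
    intro g
    simp only [Finset.sum_filter, Finset.mul_sum]
    rw [Finset.sum_comm]
    refine Finset.sum_congr rfl fun e _ => ?_
    simp [mul_comm]
  simp only [mul_sub, Finset.sum_sub_distrib, key]

lemma abs_pair {r K a c : ℝ} (h : |r| ≤ K) (ha : 0 ≤ a) (hc : 0 ≤ c) :
    r * (a - c) ≤ K * (a + c) := by
  obtain ⟨h1, h2⟩ := abs_le.mp h
  nlinarith [mul_nonneg ha (sub_nonneg.mpr h2), mul_nonneg hc (by linarith : 0 ≤ K + r)]

/-- weak duality: for every primal feasible point and every dual
feasible point, the dual objective is at most the primal objective. -/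
theorem weak_duality {B L : Type*} [Fintype B] [Fintype L] [DecidableEq B]
    (src dst : L → B) (b t : L → ℝ) (pd pgu : B → ℝ) (M : ℝ)
    (x ξL : L → ℝ) (y ξG : B → ℝ)
    (ht : ∀ e, 0 ≤ t e) (hpd : ∀ β, 0 ≤ pd β) (hpgu : ∀ β, 0 ≤ pgu β) (hM : 0 ≤ M)
    (hx : ∀ e, x e = 0 ∨ x e = 1) (hy : ∀ β, y β = 0 ∨ y β = 1)
    (hξL : ∀ e, ξL e = 0 ∨ ξL e = 1) (hξG : ∀ β, ξG β = 0 ∨ ξG β = 1)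
    (p : L → ℝ) (θ ℓ pg : B → ℝ)
    (hp : PrimalFeasible src dst b t pd pgu M x ξL y ξG p θ ℓ pg)
    (π φ ω : B → ℝ) (γp γm δp δm : L → ℝ)
    (hd : DualFeasible src dst b pd π φ ω γp γm δp δm) :
    dualObj t pd pgu M x ξL y ξG π φ ω γp γm δp δm ≤ ∑ β, pd β * ℓ β := by
  obtain ⟨p1, p2, p3, p4, p5⟩ := hp
  obtain ⟨d1, d2, d3, d4, d5, d6⟩ := hd
  unfold dualObj
  have h1 := sum_net src dst π p
  have h2 := sum_net src dst θ (fun e => b e * (δp e - δm e))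
  simp only [d2, mul_zero, Finset.sum_const_zero] at h2
  have hB : ∑ β, ((y β - 1) * ξG β * pgu β * φ β - ω β - pd β * π β) ≤
      ∑ β, (π β * (pg β - pd β * (1 - ℓ β)) + pd β * ℓ β) := by
    refine Finset.sum_le_sum fun β _ => ?_
    obtain ⟨hφ, hω⟩ := d5 β
    obtain ⟨l0, l1⟩ := p5 β
    have e1 : π β = -φ β := by linarith [d3 β]
    have a1 := mul_le_mul_of_nonneg_right (p2 β).2 hφ
    have a2 := mul_le_mul_of_nonneg_left (d4 β) l0
    have a3 := mul_nonneg hω (sub_nonneg.mpr l1)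
    rw [e1] at a2 ⊢
    nlinarith
  have hL : ∑ e, (p e * (π (dst e) - π (src e)) -
        b e * (δp e - δm e) * (θ (dst e) - θ (src e))) ≤
      ∑ e, (M * x e * (1 - ξL e) * (δp e + δm e) +
         (1 - x e) * ξL e * t e * (γp e + γm e)) := by
    refine Finset.sum_le_sum fun e _ => ?_
    obtain ⟨g1, g2, g3, g4⟩ := d6 e
    have a1 := abs_pair (p3 e) g1 g2
    have a2 := abs_pair (p4 e) g3 g4
    have e1 : π (dst e) - π (src e) = (γp e - γm e) + (δp e - δm e) := by linarith [d1 e]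
    rw [e1]
    linarith
  rw [Finset.sum_sub_distrib, ← h2] at hL
  simp only [← p1] at h1
  rw [Finset.sum_add_distrib, h1] at hB
  linarith
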